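/- For every integer n ≥ 1, n^n = Σ_{(T,v*) ∈ 𝒜*_n} ∏_{v internal vertex of T} b(v), where b(v)=h_v if v lies on the path from the root to the distinguished vertex (endpoints included) and b(v)=h_v+1 otherwise, and the sum is over all pointed André trees on n vertices. -/

import Mathlib

open scoped Classical

noncomputable section

/-- An André tree on `n` vertices, encoded by its parent map `p` on `Fin n`
(vertex `i` stands for label `i+1`): every non-root vertex points to a strictly
larger parent, the root (label `n`) is a fixed point by convention, and each
vertex has at most two children. -/
def IsAndreTree (n : ℕ) (p : Fin n → Fin n) : Prop :=
  (∀ i : Fin n, (i : ℕ) + 1 < n → (i : ℕ) < (p i : ℕ)) ∧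
  (∀ i : Fin n, ¬ (i : ℕ) + 1 < n → p i = i) ∧
  ∀ j : Fin n, (Finset.univ.filter fun i : Fin n => (i : ℕ) + 1 < n ∧ p i = j).card ≤ 2

/-- The set of André trees on `n` vertices. -/
def andreTrees (n : ℕ) : Finset (Fin n → Fin n) :=
  Finset.univ.filter (IsAndreTree n)

/-- The hook length of the vertex `v`: the number of vertices in the subtree
rooted at `v`, i.e. the number of vertices `w` having `v` as an ancestor. -/
def hookA (n : ℕ) (p : Fin n → Fin n) (v : Fin n) : ℕ :=
  (Finset.univ.filter fun w : Fin n => ∃ k < n, p^[k] w = v).card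

/-- The set of internal vertices, i.e. vertices with hook length `> 1`. -/
def internalsA (n : ℕ) (p : Fin n → Fin n) : Finset (Fin n) :=
  Finset.univ.filter fun v => 1 < hookA n p v

/-- The number of children of the vertex `v`. -/
def childCount (n : ℕ) (p : Fin n → Fin n) (v : Fin n) : ℕ :=
  (Finset.univ.filter fun i : Fin n => (i : ℕ) + 1 < n ∧ p i = v).card

/-- The set of pointed André trees on `n` vertices: an André tree together with a
distinguished vertex having at most one child. -/
def pointedAndreTrees (n : ℕ) : Finset ((Fin n → Fin n) × Fin n) :=
  (andreTrees n ×ˢ Finset.univ).filter fun x => childCount n x.1 x.2 ≤ 1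

/-- `v` lies on the path from the root to the distinguished vertex `vstar`
(endpoints included), i.e. `v` is an ancestor of `vstar` (or `vstar` itself). -/
def OnPath (n : ℕ) (p : Fin n → Fin n) (vstar v : Fin n) : Prop :=
  ∃ k < n, p^[k] vstar = v

end

section AlgebraicIdentities

theorem sum_powersetCard_two_sum {α : Type*} [DecidableEq α] (R : Finset α) (f : α → ℤ) :
    ∑ C ∈ R.powersetCard 2, (2 + ∑ c ∈ C, f c) =
      ((R.card : ℤ) - 1) * ((∑ c ∈ R, f c) + R.card) := by
  induction R using Finset.induction_on with
  | empty =>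
    rw [Finset.powersetCard_eq_empty.2 (by simp)]
    simp
  | insert a R ha ih =>
    have key : ∑ C ∈ (insert a R).powersetCard 2, (2 + ∑ c ∈ C, f c) =
        ∑ C ∈ R.powersetCard 2, (2 + ∑ c ∈ C, f c) + ∑ c ∈ R, (2 + (f a + f c)) := by
      rw [Finset.powersetCard_succ_insert ha, Finset.sum_union, Finset.sum_image]
      · rw [Finset.powersetCard_one, Finset.sum_map]
        congr 1
        refine Finset.sum_congr rfl fun c hc => ?_
        have : a ≠ c := fun h => ha (h ▸ hc)
        simp [Finset.sum_pair this]
      · intro C hC D hD h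
        have hC' := (Finset.mem_powersetCard.1 hC).1
        have hD' := (Finset.mem_powersetCard.1 hD).1
        rw [← Finset.erase_insert (fun h => ha (hC' h)), h,
          Finset.erase_insert (fun h => ha (hD' h))]
      · rw [Finset.disjoint_left]
        intro C hC hC'
        obtain ⟨D, -, rfl⟩ := Finset.mem_image.1 hC'
        exact ha ((Finset.mem_powersetCard.1 hC).1 (Finset.mem_insert_self a D))
    rw [key, ih, Finset.sum_insert ha, Finset.card_insert_of_notMem ha]
    simp only [Finset.sum_add_distrib, Finset.sum_const, nsmul_eq_mul]
    push_cast
    ring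

theorem sum_powerset_card_le_two {α : Type*} [DecidableEq α] (R : Finset α) (g : Finset α → ℤ) :
    ∑ C ∈ R.powerset with C.card ≤ 2, g C =
      g ∅ + ∑ c ∈ R, g {c} + ∑ C ∈ R.powersetCard 2, g C := by
  have h : R.powerset.filter (fun C => C.card ≤ 2) =
      (Finset.range 3).biUnion fun k => R.powersetCard k := by
    ext C
    simp [Finset.mem_powersetCard, Nat.lt_succ_iff]
    tauto
  rw [h, Finset.sum_biUnion]
  · simp [Finset.sum_range_succ, Finset.powersetCard_one]
  · exact fun _ _ _ _ hkl => Finset.pairwise_disjoint_powersetCard R hkl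

/-- The weights of the sets of at most two roots that can be joined below a new vertex,
when the root `c` contributes `f c`. -/
theorem sum_weights_card_le_two {α : Type*} [DecidableEq α] (R : Finset α) (f : α → ℤ) (s : ℤ)
    (hs : ∑ c ∈ R, f c = s) (F : ℕ → ℤ) :
    ∑ C ∈ R.powerset with C.card ≤ 2,
        (if C = ∅ then 1 else 2 + ∑ c ∈ C, f c) * F (R.card + 1 - C.card) =
      F (R.card + 1) + (s + 2 * R.card) * F R.card +
        ((R.card : ℤ) - 1) * (s + R.card) * F (R.card - 1) := by
  rw [sum_powerset_card_le_two]
  congr 1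
  · congr 1
    · simp
    · simp only [Finset.singleton_ne_empty, if_false, Finset.sum_singleton,
        Finset.card_singleton, Nat.add_sub_cancel, ← Finset.sum_mul, Finset.sum_add_distrib, hs,
        Finset.sum_const, nsmul_eq_mul]
      ring
  · rw [← hs, ← sum_powersetCard_two_sum, Finset.sum_mul]
    refine Finset.sum_congr rfl fun C hC => ?_
    have hC' := (Finset.mem_powersetCard.1 hC).2
    rw [if_neg (by rintro rfl; simp at hC'), hC']
    rfl

theorem sum_weights_card_le_one {α : Type*} [DecidableEq α] (R : Finset α) (f : α → ℤ) (s : ℤ)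
    (hs : ∑ c ∈ R, f c = s) (F : ℕ → ℤ) :
    ∑ C ∈ R.powerset with C.card ≤ 2,
        (if C.card ≤ 1 then (1 + ∑ c ∈ C, f c) * F (R.card + 1 - C.card) else 0) =
      F (R.card + 1) + (s + R.card) * F R.card := by
  rw [sum_powerset_card_le_two, Finset.sum_eq_zero (s := R.powersetCard 2)]
  · simp only [Finset.card_empty, zero_le, if_true, Finset.sum_empty, add_zero, Nat.sub_zero,
      one_mul, le_refl, Finset.sum_singleton, Finset.card_singleton, Nat.add_sub_cancel,
      ← Finset.sum_mul, Finset.sum_add_distrib, hs, Finset.sum_const, nsmul_eq_mul]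
    ring
  · intro C hC
    rw [(Finset.mem_powersetCard.1 hC).2]
    simp

theorem cast_descFactorial_succ (k r : ℕ) :
    (k.descFactorial (r + 1) : ℤ) = (k - r) * k.descFactorial r := by
  rw [Nat.descFactorial_succ]
  rcases le_or_gt r k with h | h
  · push_cast [Nat.cast_sub h]; rfl
  · simp [Nat.descFactorial_of_lt h]

theorem descFactorial_recurrence_unmarked (n i k r : ℕ) (h : i + (k + 1) = n) :
    (n : ℤ) ^ (k + 1) * (k + 1).descFactorial r =
      ((n : ℤ) ^ k * k.descFactorial (r + 1) + (i + 2 * r) * ((n : ℤ) ^ k * k.descFactorial r) +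
        ((r : ℤ) - 1) * (i + r) * ((n : ℤ) ^ k * k.descFactorial (r - 1))) +
      ((n : ℤ) ^ k * k.descFactorial (r + 1 - 1) +
        (i + r) * ((n : ℤ) ^ k * k.descFactorial (r - 1))) := by
  subst h
  cases r with
  | zero => simp; ring
  | succ r =>
    simp only [Nat.add_sub_cancel, Nat.succ_descFactorial_succ, cast_descFactorial_succ]
    push_cast [cast_descFactorial_succ]
    ring

theorem descFactorial_recurrence_marked (n i k r : ℕ) (h : i + (k + 1) = n) (hr : 1 ≤ r) :
    (n : ℤ) ^ (k + 1) * (k + 1).descFactorial (r - 1) =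
      (n : ℤ) ^ k * k.descFactorial (r + 1 - 1) +
        ((i : ℤ) - 1 + 2 * r) * ((n : ℤ) ^ k * k.descFactorial (r - 1)) +
        ((r : ℤ) - 1) * ((i : ℤ) - 1 + r) * ((n : ℤ) ^ k * k.descFactorial (r - 1 - 1)) := by
  subst h
  obtain ⟨r, rfl⟩ := Nat.exists_eq_add_of_le' hr
  cases r with
  | zero => simp; ring
  | succ r =>
    simp only [Nat.add_sub_cancel, Nat.succ_descFactorial_succ, cast_descFactorial_succ]
    push_cast [cast_descFactorial_succ]
    ring

end AlgebraicIdentities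

noncomputable section

variable {n : ℕ}

/-- `v` is an ancestor of `w` (or `w` itself) for the parent map `p`. -/
def Reaches (p : Fin n → Fin n) (w v : Fin n) : Prop := ∃ k, p^[k] w = v

/-- The number of vertices having `v` as an ancestor. -/
def hookSize (p : Fin n → Fin n) (v : Fin n) : ℕ :=
  (Finset.univ.filter fun w => Reaches p w v).card

/-- The children of `v`. -/
def kids (p : Fin n → Fin n) (v : Fin n) : Finset (Fin n) :=
  Finset.univ.filter fun j => j ≠ v ∧ p j = v

/-- The roots among the first `i` vertices. -/
def rootsBelow (i : ℕ) (p : Fin n → Fin n) : Finset (Fin n) :=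
  Finset.univ.filter fun j => (j : ℕ) < i ∧ p j = j

/-- The decreasing forests with at most two children per vertex on the first `i` vertices;
roots, and all later vertices, are fixed points. -/
def forestsBelow (n i : ℕ) : Finset (Fin n → Fin n) :=
  Finset.univ.filter fun p =>
    (∀ j, p j ≠ j → j < p j ∧ (p j : ℕ) < i) ∧ ∀ v, (kids p v).card ≤ 2

/-- Make `m` the parent of all the vertices in `C`. -/
def graft (p : Fin n → Fin n) (C : Finset (Fin n)) (m : Fin n) : Fin n → Fin n :=
  fun j => if j ∈ C then m else p j

/-- The factor of the vertex `u`, when the vertices in `s` are distinguished. -/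
def vertexWeight (p : Fin n → Fin n) (s : Finset (Fin n)) (u : Fin n) : ℤ :=
  if hookSize p u ≤ 1 then 1
  else if ∃ v ∈ s, Reaches p v u then hookSize p u else hookSize p u + 1

/-- The product of the factors of the first `i` vertices. -/
def forestWeight (i : ℕ) (p : Fin n → Fin n) (s : Finset (Fin n)) : ℤ :=
  ∏ u ∈ Finset.univ.filter (fun u : Fin n => (u : ℕ) < i), vertexWeight p s u

end

section Reaches

variable {n : ℕ} {p : Fin n → Fin n}

theorem Reaches.refl (p : Fin n → Fin n) (w : Fin n) : Reaches p w w := ⟨0, rfl⟩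

theorem reaches_iff (w v : Fin n) : Reaches p w v ↔ w = v ∨ Reaches p (p w) v := by
  constructor
  · rintro ⟨k, hk⟩
    cases k with
    | zero => exact Or.inl hk
    | succ k => exact Or.inr ⟨k, hk⟩
  · rintro (h | ⟨k, hk⟩)
    · exact ⟨0, h⟩
    · exact ⟨k + 1, hk⟩

theorem reaches_of_fixed {w v : Fin n} (hw : p w = w) : Reaches p w v ↔ w = v := by
  constructor
  · rintro ⟨k, hk⟩
    rwa [Function.iterate_fixed hw] at hk
  · rintro rfl
    exact Reaches.refl p w

theorem Reaches.induction {v : Fin n} {P : Fin n → Prop} (hv : P v)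
    (hstep : ∀ w, Reaches p (p w) v → P (p w) → P w) {w : Fin n} (h : Reaches p w v) : P w := by
  obtain ⟨k, hk⟩ := h
  induction k generalizing w with
  | zero =>
    obtain rfl : w = v := hk
    exact hv
  | succ k ih => exact hstep w ⟨k, hk⟩ (ih hk)

theorem Reaches.eq_of_fixed {w c d : Fin n} (hc : p c = c) (hd : p d = d) (h : Reaches p w c)
    (h' : Reaches p w d) : c = d := by
  revert h'
  refine Reaches.induction (P := fun w => Reaches p w d → c = d) ?_ ?_ h
  · exact (reaches_of_fixed hc).1
  · intro w hw ih hwd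
    rcases (reaches_iff w d).1 hwd with rfl | h'
    · exact ih (by rw [hd]; exact Reaches.refl _ _)
    · exact ih h'

theorem Reaches.le (hp : ∀ j, j ≤ p j) {w v : Fin n} (h : Reaches p w v) : w ≤ v :=
  Reaches.induction (P := fun w => w ≤ v) le_rfl (fun w _ h => (hp w).trans h) h

theorem reaches_iff_exists_lt (hp : ∀ j, j ≤ p j) {w v : Fin n} :
    (∃ k < n, p^[k] w = v) ↔ Reaches p w v := by
  refine ⟨fun ⟨k, _, h⟩ => ⟨k, h⟩, fun h => ?_⟩
  have : ∃ k, k + (w : ℕ) ≤ v ∧ p^[k] w = v := by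
    refine Reaches.induction (P := fun w => ∃ k, k + (w : ℕ) ≤ v ∧ p^[k] w = v)
      ⟨0, by simp⟩ ?_ h
    rintro w - ⟨k, hk, hk'⟩
    rcases (hp w).eq_or_lt with h | h
    · exact ⟨k, by rwa [← h] at hk, by rwa [← h] at hk'⟩
    · have : (w : ℕ) < p w := h
      exact ⟨k + 1, by omega, hk'⟩
  obtain ⟨k, hk, hk'⟩ := this
  exact ⟨k, by omega, hk'⟩

end Reaches

section Forests

variable {n i : ℕ} {p : Fin n → Fin n}

theorem mem_kids {v j : Fin n} : j ∈ kids p v ↔ j ≠ v ∧ p j = v := by simp [kids]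

theorem mem_rootsBelow {j : Fin n} : j ∈ rootsBelow i p ↔ (j : ℕ) < i ∧ p j = j := by
  simp [rootsBelow]

theorem mem_forestsBelow :
    p ∈ forestsBelow n i ↔
      (∀ j, p j ≠ j → j < p j ∧ (p j : ℕ) < i) ∧ ∀ v, (kids p v).card ≤ 2 := by
  simp [forestsBelow]

theorem le_of_mem_forestsBelow (hp : p ∈ forestsBelow n i) (j : Fin n) : j ≤ p j := by
  by_cases h : p j = j
  · exact h.ge
  · exact ((mem_forestsBelow.1 hp).1 j h).1.le

theorem lt_of_mem_forestsBelow (hp : p ∈ forestsBelow n i) {j : Fin n} (hj : p j ≠ j) :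
    (j : ℕ) < i ∧ (p j : ℕ) < i := by
  obtain ⟨h1, h2⟩ := (mem_forestsBelow.1 hp).1 j hj
  exact ⟨lt_trans h1 h2, h2⟩

theorem fixed_of_mem_forestsBelow (hp : p ∈ forestsBelow n i) {j : Fin n} (hj : i ≤ (j : ℕ)) :
    p j = j := by
  by_contra h
  exact absurd (lt_of_mem_forestsBelow hp h).1 hj.not_gt

theorem exists_root_reaches (hp : p ∈ forestsBelow n i) (w : Fin n) (hw : (w : ℕ) < i) :
    ∃ c ∈ rootsBelow i p, Reaches p w c := by
  induction w using WellFoundedGT.induction with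
  | ind w ih =>
    by_cases h : p w = w
    · exact ⟨w, mem_rootsBelow.2 ⟨hw, h⟩, Reaches.refl p w⟩
    · obtain ⟨h1, h2⟩ := (mem_forestsBelow.1 hp).1 w h
      obtain ⟨c, hc, hwc⟩ := ih (p w) h1 h2
      exact ⟨c, hc, (reaches_iff w c).2 (Or.inr hwc)⟩

theorem card_biUnion_hook {C : Finset (Fin n)} (hC : ∀ c ∈ C, p c = c) :
    ((Finset.univ.filter fun w => ∃ c ∈ C, Reaches p w c).card) = ∑ c ∈ C, hookSize p c := by
  rw [show (Finset.univ.filter fun w => ∃ c ∈ C, Reaches p w c) =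
    C.biUnion fun c => Finset.univ.filter fun w => Reaches p w c by ext; simp]
  refine Finset.card_biUnion fun c hc d hd hcd => ?_
  refine Finset.disjoint_left.2 ?_
  intro w hw hw'
  exact hcd (Reaches.eq_of_fixed (hC c hc) (hC d hd) (Finset.mem_filter.1 hw).2
    (Finset.mem_filter.1 hw').2)

theorem sum_hookSize_roots (hp : p ∈ forestsBelow n i) (hi : i ≤ n) :
    ∑ c ∈ rootsBelow i p, hookSize p c = i := by
  rw [← card_biUnion_hook fun c hc => (mem_rootsBelow.1 hc).2]
  have : (Finset.univ.filter fun w : Fin n => ∃ c ∈ rootsBelow i p, Reaches p w c) =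
      Finset.univ.filter fun w : Fin n => (w : ℕ) < i := by
    ext w
    simp only [Finset.mem_filter, Finset.mem_univ, true_and]
    refine ⟨fun ⟨c, hc, h⟩ => ?_, exists_root_reaches hp w⟩
    exact lt_of_le_of_lt (Reaches.le (le_of_mem_forestsBelow hp) h) (mem_rootsBelow.1 hc).1
  rw [this, Fin.card_filter_val_lt, min_eq_right hi]

theorem card_filter_reaches_roots {C : Finset (Fin n)} (hC : ∀ c ∈ C, p c = c) (v : Fin n) :
    (C.filter fun c => Reaches p v c).card = if ∃ c ∈ C, Reaches p v c then 1 else 0 := by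
  split_ifs with h
  · obtain ⟨c, hc, h⟩ := h
    rw [Finset.card_eq_one]
    refine ⟨c, ?_⟩
    ext d
    simp only [Finset.mem_filter, Finset.mem_singleton]
    refine ⟨fun hd => Reaches.eq_of_fixed (hC d hd.1) (hC c hc) hd.2 h, ?_⟩
    rintro rfl
    exact ⟨hc, h⟩
  · rw [Finset.card_eq_zero, Finset.filter_eq_empty_iff]
    exact fun c hc hvc => h ⟨c, hc, hvc⟩

end Forests

section Graft

variable {n i : ℕ} {p : Fin n → Fin n} {C : Finset (Fin n)} {m : Fin n}

theorem graft_of_mem {j : Fin n} (hj : j ∈ C) : graft p C m j = m := if_pos hj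

theorem graft_of_notMem {j : Fin n} (hj : j ∉ C) : graft p C m j = p j := if_neg hj

theorem notMem_of_subset_roots (hC : C ⊆ rootsBelow i p) {v : Fin n} (hv : i ≤ (v : ℕ)) :
    v ∉ C := fun h => absurd (mem_rootsBelow.1 (hC h)).1 hv.not_gt

theorem kids_graft_self (hp : p ∈ forestsBelow n i) (hC : C ⊆ rootsBelow i p)
    (hm : (m : ℕ) = i) : kids (graft p C m) m = C := by
  ext j
  rw [mem_kids]
  by_cases hj : j ∈ C
  · simp only [graft_of_mem hj, hj, and_true, iff_true]
    rintro rfl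
    exact notMem_of_subset_roots hC hm.ge hj
  · simp only [graft_of_notMem hj, hj, iff_false]
    rintro ⟨h1, rfl⟩
    have := (lt_of_mem_forestsBelow hp h1.symm).2
    omega

theorem kids_graft_of_ne (hC : C ⊆ rootsBelow i p) {v : Fin n} (hv : v ≠ m) :
    kids (graft p C m) v = kids p v := by
  ext j
  rw [mem_kids, mem_kids]
  by_cases hj : j ∈ C
  · have h := (mem_rootsBelow.1 (hC hj)).2
    rw [graft_of_mem hj, h]
    exact ⟨fun h => absurd h.2.symm hv, fun h => absurd h.2 h.1⟩
  · rw [graft_of_notMem hj]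

theorem graft_mem_forestsBelow (hp : p ∈ forestsBelow n i) (hC : C ⊆ rootsBelow i p)
    (hC2 : C.card ≤ 2) (hm : (m : ℕ) = i) : graft p C m ∈ forestsBelow n (i + 1) := by
  rw [mem_forestsBelow]
  constructor
  · intro j hj
    by_cases hjC : j ∈ C
    · rw [graft_of_mem hjC, Fin.lt_def, hm]
      exact ⟨(mem_rootsBelow.1 (hC hjC)).1, i.lt_succ_self⟩
    · rw [graft_of_notMem hjC] at hj ⊢
      exact ((mem_forestsBelow.1 hp).1 j hj).imp_right Nat.lt_succ_of_lt
  · intro v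
    by_cases hv : v = m
    · rwa [hv, kids_graft_self hp hC hm]
    · rw [kids_graft_of_ne hC hv]
      exact (mem_forestsBelow.1 hp).2 v

theorem rootsBelow_graft (hp : p ∈ forestsBelow n i) (hC : C ⊆ rootsBelow i p)
    (hm : (m : ℕ) = i) :
    rootsBelow (i + 1) (graft p C m) = insert m (rootsBelow i p \ C) := by
  have hmC : m ∉ C := notMem_of_subset_roots hC hm.ge
  ext j
  rw [Finset.mem_insert, Finset.mem_sdiff, mem_rootsBelow, mem_rootsBelow]
  by_cases hj : j ∈ C
  · have hjm : j ≠ m := fun h => hmC (h ▸ hj)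
    simp [graft_of_mem hj, hj, hjm, hjm.symm]
  · rw [graft_of_notMem hj]
    by_cases hjm : j = m
    · subst hjm
      simp [hm, fixed_of_mem_forestsBelow hp hm.ge]
    · have : (j : ℕ) ≠ i := fun h => hjm (Fin.ext (h.trans hm.symm))
      simp only [hjm, hj, false_or, not_false_eq_true, and_true]
      refine and_congr_left fun _ => ?_
      omega

theorem card_rootsBelow_graft (hp : p ∈ forestsBelow n i) (hC : C ⊆ rootsBelow i p)
    (hm : (m : ℕ) = i) :
    (rootsBelow (i + 1) (graft p C m)).card = (rootsBelow i p).card + 1 - C.card := by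
  rw [rootsBelow_graft hp hC hm, Finset.card_insert_of_notMem, Finset.card_sdiff_of_subset hC]
  · have := Finset.card_le_card hC
    omega
  · simp [mem_rootsBelow, hm]

theorem reaches_graft_of_ne (hp : p ∈ forestsBelow n i) (hC : C ⊆ rootsBelow i p)
    (hm : (m : ℕ) = i) {w v : Fin n} (hv : v ≠ m) :
    Reaches (graft p C m) w v ↔ Reaches p w v := by
  have hmC : m ∉ C := notMem_of_subset_roots hC hm.ge
  have hmfix : graft p C m m = m := by
    rw [graft_of_notMem hmC, fixed_of_mem_forestsBelow hp hm.ge]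
  constructor
  · refine fun h => Reaches.induction (P := fun w => Reaches p w v) (Reaches.refl p v) ?_ h
    intro w hw ih
    by_cases hwC : w ∈ C
    · rw [graft_of_mem hwC, reaches_of_fixed hmfix] at hw
      exact absurd hw.symm hv
    · rw [graft_of_notMem hwC] at ih
      exact (reaches_iff w v).2 (Or.inr ih)
  · refine fun h => Reaches.induction (P := fun w => Reaches (graft p C m) w v)
      (Reaches.refl _ v) ?_ h
    intro w hw ih
    by_cases hwC : w ∈ C
    · rwa [(mem_rootsBelow.1 (hC hwC)).2] at ih
    · rw [← graft_of_notMem (p := p) (m := m) hwC] at ih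
      exact (reaches_iff w v).2 (Or.inr ih)

theorem reaches_graft_self (hp : p ∈ forestsBelow n i) (hm : (m : ℕ) = i) {w : Fin n} :
    Reaches (graft p C m) w m ↔ w = m ∨ ∃ c ∈ C, Reaches p w c := by
  constructor
  · refine fun h => Reaches.induction (P := fun w => w = m ∨ ∃ c ∈ C, Reaches p w c)
      (Or.inl rfl) ?_ h
    intro w _ ih
    by_cases hwC : w ∈ C
    · exact Or.inr ⟨w, hwC, Reaches.refl p w⟩
    · rw [graft_of_notMem hwC] at ih
      rcases ih with ih | ⟨c, hc, ih⟩
      · by_cases hwm : w = m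
        · exact Or.inl hwm
        · have := (lt_of_mem_forestsBelow hp (j := w) (by rw [ih]; exact Ne.symm hwm)).2
          rw [ih] at this
          omega
      · exact Or.inr ⟨c, hc, (reaches_iff w c).2 (Or.inr ih)⟩
  · rintro (rfl | ⟨c, hc, h⟩)
    · exact Reaches.refl _ _
    · refine Reaches.induction (P := fun w => Reaches (graft p C m) w m) ?_ ?_ h
      · rw [reaches_iff, graft_of_mem hc]
        exact Or.inr (Reaches.refl _ _)
      · intro w _ ih
        rw [reaches_iff]
        by_cases hwC : w ∈ C
        · rw [graft_of_mem hwC]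
          exact Or.inr (Reaches.refl _ _)
        · rw [graft_of_notMem hwC]
          exact Or.inr ih

theorem hookSize_graft_of_ne (hp : p ∈ forestsBelow n i) (hC : C ⊆ rootsBelow i p)
    (hm : (m : ℕ) = i) {v : Fin n} (hv : v ≠ m) :
    hookSize (graft p C m) v = hookSize p v := by
  simp only [hookSize, reaches_graft_of_ne hp hC hm hv]

theorem hookSize_graft_self (hp : p ∈ forestsBelow n i) (hC : C ⊆ rootsBelow i p)
    (hm : (m : ℕ) = i) : hookSize (graft p C m) m = 1 + ∑ c ∈ C, hookSize p c := by
  rw [← card_biUnion_hook fun c hc => (mem_rootsBelow.1 (hC hc)).2, hookSize, add_comm,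
    ← Finset.card_insert_of_notMem (a := m)]
  · congr 1
    ext w
    simp [reaches_graft_self hp hm]
  · simp only [Finset.mem_filter, Finset.mem_univ, true_and, not_exists, not_and]
    intro c hc h
    rw [reaches_of_fixed (fixed_of_mem_forestsBelow hp hm.ge)] at h
    exact notMem_of_subset_roots hC hm.ge (h ▸ hc)

theorem one_le_hookSize (p : Fin n → Fin n) (v : Fin n) : 1 ≤ hookSize p v :=
  Finset.card_pos.2 ⟨v, by simp [Reaches.refl]⟩

theorem hookSize_graft_self_le_one_iff (hp : p ∈ forestsBelow n i) (hC : C ⊆ rootsBelow i p)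
    (hm : (m : ℕ) = i) : hookSize (graft p C m) m ≤ 1 ↔ C = ∅ := by
  rw [hookSize_graft_self hp hC hm]
  constructor
  · intro h
    by_contra hne
    obtain ⟨c, hc⟩ := Finset.nonempty_iff_ne_empty.2 hne
    have h1 := Finset.single_le_sum (f := hookSize p) (fun _ _ => Nat.zero_le _) hc
    have h2 := one_le_hookSize p c
    omega
  · rintro rfl
    simp

theorem sum_forestsBelow_succ (hm : (m : ℕ) = i) (F : (Fin n → Fin n) → ℤ) :
    ∑ q ∈ forestsBelow n (i + 1), F q =
      ∑ p ∈ forestsBelow n i, ∑ C ∈ (rootsBelow i p).powerset with C.card ≤ 2,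
        F (graft p C m) := by
  rw [Finset.sum_sigma']
  symm
  refine Finset.sum_bij' (fun x _ => graft x.1 x.2 m)
    (fun q _ => ⟨fun j => if q j = m then j else q j, kids q m⟩) ?_ ?_ ?_ ?_ ?_
  · rintro ⟨p, C⟩ h
    simp only [Finset.mem_sigma, Finset.mem_filter, Finset.mem_powerset] at h
    exact graft_mem_forestsBelow h.1 h.2.1 h.2.2 hm
  · intro q hq
    have hq' := mem_forestsBelow.1 hq
    simp only [Finset.mem_sigma, Finset.mem_filter, Finset.mem_powerset]
    refine ⟨mem_forestsBelow.2 ⟨fun j hj => ?_, fun v => ?_⟩, fun j hj => ?_, hq'.2 m⟩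
    · by_cases h : q j = m
      · simp [h] at hj
      · simp only [h, if_false] at hj ⊢
        have h1 := hq'.1 j hj
        have h2 : (q j : ℕ) ≠ i := fun h' => h (Fin.ext (h'.trans hm.symm))
        exact ⟨h1.1, by omega⟩
    · refine (Finset.card_le_card fun j hj => ?_).trans (hq'.2 v)
      rw [mem_kids] at hj ⊢
      obtain ⟨h1, h2⟩ := hj
      by_cases h : q j = m
      · simp only [h, if_true] at h2
        exact absurd h2 h1
      · simp only [h, if_false] at h2
        exact ⟨h1, h2⟩
    · rw [mem_kids] at hj
      have h1 := (hq'.1 j (by rw [hj.2]; exact hj.1.symm)).1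
      rw [hj.2, Fin.lt_def, hm] at h1
      simp [mem_rootsBelow, h1, hj.2]
  · rintro ⟨p, C⟩ h
    simp only [Finset.mem_sigma, Finset.mem_filter, Finset.mem_powerset] at h
    obtain ⟨hp, hC, -⟩ := h
    have h1 : (fun j => if graft p C m j = m then j else graft p C m j) = p := by
      funext j
      by_cases hj : j ∈ C
      · simp [graft_of_mem hj, (mem_rootsBelow.1 (hC hj)).2]
      · rw [graft_of_notMem hj]
        split_ifs with h
        · by_contra hne
          have := (lt_of_mem_forestsBelow hp (Ne.symm hne)).2
          rw [h] at this
          omega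
        · rfl
    simp only [h1, kids_graft_self hp hC hm]
  · intro q hq
    funext j
    by_cases hj : j ∈ kids q m
    · rw [graft_of_mem hj, (mem_kids.1 hj).2]
    · rw [graft_of_notMem hj]
      rw [mem_kids] at hj
      by_cases h : q j = m
      · have : j = m := by
          by_contra h'
          exact hj ⟨h', h⟩
        exact (if_pos h).trans (this.trans h.symm)
      · simp [h]
  · intros
    rfl

end Graft

section Weights

variable {n i : ℕ} {p : Fin n → Fin n} {C : Finset (Fin n)} {m : Fin n}

theorem forestWeight_graft (hp : p ∈ forestsBelow n i) (hC : C ⊆ rootsBelow i p)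
    (hm : (m : ℕ) = i) (s : Finset (Fin n)) :
    forestWeight (i + 1) (graft p C m) s =
      vertexWeight (graft p C m) s m * forestWeight i p s := by
  have h : (Finset.univ.filter fun u : Fin n => (u : ℕ) < i + 1) =
      insert m (Finset.univ.filter fun u : Fin n => (u : ℕ) < i) := by
    ext u
    simp only [Finset.mem_filter, Finset.mem_univ, true_and, Finset.mem_insert, Fin.ext_iff, hm]
    omega
  rw [forestWeight, h, Finset.prod_insert (by simp [hm]), forestWeight]
  congr 1
  refine Finset.prod_congr rfl fun u hu => ?_
  have hum : u ≠ m := by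
    rintro rfl
    simp [hm] at hu
  simp only [vertexWeight, hookSize_graft_of_ne hp hC hm hum,
    reaches_graft_of_ne hp hC hm hum]

theorem forestWeight_singleton_new (hp : p ∈ forestsBelow n i) (hm : (m : ℕ) = i) :
    forestWeight i p {m} = forestWeight i p ∅ := by
  refine Finset.prod_congr rfl fun u hu => ?_
  have hum : m ≠ u := by
    rintro rfl
    simp [hm] at hu
  simp [vertexWeight, reaches_of_fixed (fixed_of_mem_forestsBelow hp hm.ge), hum]

theorem vertexWeight_graft_empty (hp : p ∈ forestsBelow n i) (hC : C ⊆ rootsBelow i p)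
    (hm : (m : ℕ) = i) :
    vertexWeight (graft p C m) ∅ m =
      if C = ∅ then 1 else 2 + ∑ c ∈ C, (hookSize p c : ℤ) := by
  simp only [vertexWeight, hookSize_graft_self_le_one_iff hp hC hm]
  refine if_congr Iff.rfl rfl ?_
  rw [if_neg (by simp), hookSize_graft_self hp hC hm]
  push_cast
  ring

theorem vertexWeight_graft_new (hp : p ∈ forestsBelow n i) (hC : C ⊆ rootsBelow i p)
    (hm : (m : ℕ) = i) :
    vertexWeight (graft p C m) {m} m = 1 + ∑ c ∈ C, (hookSize p c : ℤ) := by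
  simp only [vertexWeight, hookSize_graft_self_le_one_iff hp hC hm]
  split_ifs with h h'
  · simp [h]
  · rw [hookSize_graft_self hp hC hm]
    push_cast
    rfl
  · exact absurd ⟨m, by simp, Reaches.refl _ _⟩ h'

theorem vertexWeight_graft_old (hp : p ∈ forestsBelow n i) (hC : C ⊆ rootsBelow i p)
    (hm : (m : ℕ) = i) {v : Fin n} (hv : v ≠ m) :
    vertexWeight (graft p C m) {v} m =
      if C = ∅ then 1
      else 2 + ∑ c ∈ C, ((hookSize p c : ℤ) - if Reaches p v c then 1 else 0) := by
  simp only [vertexWeight, hookSize_graft_self_le_one_iff hp hC hm]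
  refine if_congr Iff.rfl rfl ?_
  rw [Finset.sum_sub_distrib, Finset.sum_boole,
    card_filter_reaches_roots fun c hc => (mem_rootsBelow.1 (hC hc)).2,
    hookSize_graft_self hp hC hm]
  simp only [Finset.mem_singleton, exists_eq_left, reaches_graft_self hp hm, hv, false_or]
  split_ifs <;> push_cast <;> ring

/-- The total weight of the forests on the first `i` vertices, with the factor `F r` for those
with `r` roots. -/
noncomputable def unmarkedSum (n i : ℕ) (F : ℕ → ℤ) : ℤ :=
  ∑ p ∈ forestsBelow n i, forestWeight i p ∅ * F (rootsBelow i p).card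

/-- The total weight of the forests on the first `i` vertices with a marked vertex having at
most one child, with the factor `F r` for those with `r` roots. -/
noncomputable def markedSum (n i : ℕ) (F : ℕ → ℤ) : ℤ :=
  ∑ p ∈ forestsBelow n i,
    ∑ v ∈ Finset.univ.filter (fun v : Fin n => (v : ℕ) < i ∧ (kids p v).card ≤ 1),
      forestWeight i p {v} * F (rootsBelow i p).card

theorem unmarkedSum_succ (hi : i < n) (F : ℕ → ℤ) :
    unmarkedSum n (i + 1) F = unmarkedSum n i fun r =>
      F (r + 1) + (i + 2 * r) * F r + ((r : ℤ) - 1) * (i + r) * F (r - 1) := by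
  have hm : ((⟨i, hi⟩ : Fin n) : ℕ) = i := rfl
  rw [unmarkedSum, unmarkedSum, sum_forestsBelow_succ hm]
  refine Finset.sum_congr rfl fun p hp => ?_
  rw [← sum_weights_card_le_two (rootsBelow i p) (fun c => (hookSize p c : ℤ)) i
    (mod_cast sum_hookSize_roots hp hi.le), Finset.mul_sum]
  refine Finset.sum_congr rfl fun C hC => ?_
  have hC' := Finset.mem_powerset.1 (Finset.mem_filter.1 hC).1
  rw [forestWeight_graft hp hC' hm, vertexWeight_graft_empty hp hC' hm,
    card_rootsBelow_graft hp hC' hm]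
  ring

theorem sum_marked_graft (hp : p ∈ forestsBelow n i) (hC : C ⊆ rootsBelow i p)
    (hm : (m : ℕ) = i) (f : Fin n → ℤ) :
    ∑ v ∈ Finset.univ.filter
        (fun v : Fin n => (v : ℕ) < i + 1 ∧ (kids (graft p C m) v).card ≤ 1), f v =
      (∑ v ∈ Finset.univ.filter (fun v : Fin n => (v : ℕ) < i ∧ (kids p v).card ≤ 1), f v) +
        if C.card ≤ 1 then f m else 0 := by
  rw [Finset.sum_filter, Finset.sum_filter, ← Finset.add_sum_erase _ _ (Finset.mem_univ m),
    ← Finset.add_sum_erase _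
      (fun v : Fin n => if (v : ℕ) < i ∧ (kids p v).card ≤ 1 then f v else 0)
      (Finset.mem_univ m), kids_graft_self hp hC hm]
  simp only [hm, lt_add_one, true_and, lt_irrefl, false_and, if_false, zero_add]
  rw [add_comm]
  congr 1
  refine Finset.sum_congr rfl fun v hv => ?_
  have hvm := Finset.ne_of_mem_erase hv
  have : (v : ℕ) ≠ i := fun h => hvm (Fin.ext (h.trans hm.symm))
  rw [kids_graft_of_ne hC hvm]
  refine if_congr (and_congr_left fun _ => ?_) rfl rfl
  omega

theorem markedSum_succ (hi : i < n) (F : ℕ → ℤ) :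
    markedSum n (i + 1) F =
      (markedSum n i fun r =>
        F (r + 1) + ((i : ℤ) - 1 + 2 * r) * F r +
          ((r : ℤ) - 1) * ((i : ℤ) - 1 + r) * F (r - 1)) +
      unmarkedSum n i fun r => F (r + 1) + (i + r) * F r := by
  obtain ⟨m, hm⟩ : ∃ m : Fin n, (m : ℕ) = i := ⟨⟨i, hi⟩, rfl⟩
  rw [markedSum, markedSum, unmarkedSum, sum_forestsBelow_succ hm, ← Finset.sum_add_distrib]
  refine Finset.sum_congr rfl fun p hp => ?_
  have hsum : ∑ c ∈ rootsBelow i p, (hookSize p c : ℤ) = i :=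
    mod_cast sum_hookSize_roots hp hi.le
  rw [Finset.sum_congr rfl fun C hC => sum_marked_graft hp
    (Finset.mem_powerset.1 (Finset.mem_filter.1 hC).1) hm _, Finset.sum_add_distrib,
    Finset.sum_comm]
  congr 1
  · refine Finset.sum_congr rfl fun v hv => ?_
    have hvi := (Finset.mem_filter.1 hv).2.1
    have hvm : v ≠ m := by
      rintro rfl
      omega
    rw [← sum_weights_card_le_two (rootsBelow i p)
      (fun c => (hookSize p c : ℤ) - if Reaches p v c then 1 else 0), Finset.mul_sum]
    · refine Finset.sum_congr rfl fun C hC => ?_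
      have hC' := Finset.mem_powerset.1 (Finset.mem_filter.1 hC).1
      rw [forestWeight_graft hp hC' hm, vertexWeight_graft_old hp hC' hm hvm,
        card_rootsBelow_graft hp hC' hm]
      ring
    · rw [Finset.sum_sub_distrib, hsum, Finset.sum_boole,
        card_filter_reaches_roots fun c hc => (mem_rootsBelow.1 hc).2,
        if_pos (exists_root_reaches hp v hvi)]
      rfl
  · rw [← sum_weights_card_le_one (rootsBelow i p) (fun c => (hookSize p c : ℤ)) i hsum,
      Finset.mul_sum]
    refine Finset.sum_congr rfl fun C hC => ?_
    have hC' := Finset.mem_powerset.1 (Finset.mem_filter.1 hC).1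
    rw [forestWeight_graft hp hC' hm, vertexWeight_graft_new hp hC' hm,
      card_rootsBelow_graft hp hC' hm, forestWeight_singleton_new hp hm]
    split_ifs <;> ring

theorem unmarkedSum_zero (F : ℕ → ℤ) : unmarkedSum n 0 F = F 0 := by
  have h : forestsBelow n 0 = {id} := by
    ext p
    rw [mem_forestsBelow, Finset.mem_singleton]
    constructor
    · rintro ⟨h, -⟩
      funext j
      by_contra hj
      exact Nat.not_lt_zero _ (h j hj).2
    · rintro rfl
      refine ⟨fun j hj => absurd rfl hj, fun v => ?_⟩
      rw [Finset.card_eq_zero.2]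
      · simp
      · ext j
        simp [mem_kids]
  simp [unmarkedSum, h, forestWeight, rootsBelow]

theorem unmarkedSum_add_markedSum (k : ℕ) (h : i + k = n) :
    unmarkedSum n i (fun r => (n : ℤ) ^ k * k.descFactorial r) +
      markedSum n i (fun r => (n : ℤ) ^ k * k.descFactorial (r - 1)) = (n : ℤ) ^ n := by
  induction i generalizing k with
  | zero =>
    obtain rfl : k = n := by omega
    rw [unmarkedSum_zero]
    simp [markedSum]
  | succ i ih =>
    rw [← ih (k + 1) (by omega), unmarkedSum_succ (by omega), markedSum_succ (by omega),
      add_left_comm, add_comm]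
    congr 1
    · rw [unmarkedSum, unmarkedSum, unmarkedSum, ← Finset.sum_add_distrib]
      refine Finset.sum_congr rfl fun p _ => ?_
      rw [descFactorial_recurrence_unmarked n i k _ (by omega)]
      ring
    · refine Finset.sum_congr rfl fun p hp => Finset.sum_congr rfl fun v hv => ?_
      obtain ⟨c, hc, -⟩ := exists_root_reaches hp v (Finset.mem_filter.1 hv).2.1
      beta_reduce
      rw [descFactorial_recurrence_marked n i k _ (by omega) (Finset.card_pos.2 ⟨c, hc⟩)]

end Weights

section AndreTrees

variable {n : ℕ} {p : Fin n → Fin n}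

theorem isAndreTree_iff (hn : 1 ≤ n) :
    IsAndreTree n p ↔ p ∈ forestsBelow n n ∧ (rootsBelow n p).card = 1 := by
  have hlast : ∀ j : Fin n, ¬ (j : ℕ) + 1 < n → j = ⟨n - 1, by omega⟩ := fun j hj =>
    Fin.ext (by simp only; omega)
  rw [mem_forestsBelow]
  constructor
  · rintro ⟨h1, h2, h3⟩
    have hfix : ∀ j, p j = j ↔ ¬ (j : ℕ) + 1 < n := fun j =>
      ⟨fun h hj => (h1 j hj).ne (by rw [h]), h2 j⟩
    refine ⟨⟨fun j hj => ?_, fun v => ?_⟩, ?_⟩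
    · exact ⟨h1 j (not_not.1 (mt (hfix j).2 hj)), (p j).2⟩
    · refine (Finset.card_le_card fun j hj => ?_).trans (h3 v)
      rw [mem_kids] at hj
      simp only [Finset.mem_filter, Finset.mem_univ, true_and]
      refine ⟨?_, hj.2⟩
      by_contra h
      exact hj.1 (((hfix j).2 h).symm.trans hj.2)
    · rw [Finset.card_eq_one]
      refine ⟨⟨n - 1, by omega⟩, ?_⟩
      ext j
      rw [mem_rootsBelow, Finset.mem_singleton, hfix]
      refine ⟨fun h => hlast j h.2, ?_⟩
      rintro rfl
      exact ⟨Fin.is_lt _, by simp only; omega⟩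
  · rintro ⟨⟨h1, h2⟩, h3⟩
    have hfixlast : p ⟨n - 1, by omega⟩ = ⟨n - 1, by omega⟩ := by
      by_contra h
      have h4 := (h1 _ h).1
      have h5 := (p ⟨n - 1, by omega⟩).2
      rw [Fin.lt_def] at h4
      simp only at h4
      omega
    obtain ⟨c, hc⟩ := Finset.card_eq_one.1 h3
    have huniq : ∀ j, p j = j → j = ⟨n - 1, by omega⟩ := fun j hj => by
      have a1 : j ∈ rootsBelow n p := mem_rootsBelow.2 ⟨j.2, hj⟩
      have a2 : (⟨n - 1, by omega⟩ : Fin n) ∈ rootsBelow n p :=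
        mem_rootsBelow.2 ⟨Fin.is_lt _, hfixlast⟩
      rw [hc, Finset.mem_singleton] at a1 a2
      rw [a1, a2]
    have hlt : ∀ j : Fin n, (j : ℕ) + 1 < n → j < p j := fun j hj => (h1 j fun h => by
      have := congrArg Fin.val (huniq j h)
      simp only at this
      omega).1
    refine ⟨hlt, fun j hj => ?_, fun v => ?_⟩
    · rw [hlast j hj, hfixlast]
    · refine (Finset.card_le_card fun j hj => ?_).trans (h2 v)
      simp only [Finset.mem_filter, Finset.mem_univ, true_and] at hj
      exact mem_kids.2 ⟨fun h => (hlt j hj.1).ne (h.trans hj.2.symm), hj.2⟩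

theorem childCount_eq (h : IsAndreTree n p) (v : Fin n) : childCount n p v = (kids p v).card := by
  rw [childCount]
  congr 1
  ext j
  rw [mem_kids]
  simp only [Finset.mem_filter, Finset.mem_univ, true_and]
  refine and_congr_left fun hj => ⟨fun hlt hjv => ?_, fun hjv => ?_⟩
  · exact (Fin.lt_def.2 (h.1 j hlt)).ne (hjv.trans hj.symm)
  · by_contra hlt
    exact hjv ((h.2.1 j hlt).symm.trans hj)

theorem prod_internalsA_eq (hp : ∀ j, j ≤ p j) (v : Fin n) :
    ((∏ u ∈ internalsA n p, (if OnPath n p v u then hookA n p u else hookA n p u + 1) : ℕ) : ℤ) =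
      forestWeight n p {v} := by
  have hhook : ∀ u, hookA n p u = hookSize p u := fun u => by
    simp only [hookA, hookSize, reaches_iff_exists_lt hp]
  have hpath : ∀ u, OnPath n p v u ↔ Reaches p v u := fun u => reaches_iff_exists_lt hp
  rw [internalsA, Finset.prod_filter, forestWeight, Finset.filter_true_of_mem fun u _ => u.2]
  push_cast
  refine Finset.prod_congr rfl fun u _ => ?_
  simp only [vertexWeight, hhook, hpath, Finset.mem_singleton, exists_eq_left]
  by_cases h : hookSize p u ≤ 1
  · rw [if_pos h, if_neg h.not_gt]
  · rw [if_neg h, if_pos (not_le.1 h)]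

end AndreTrees

/-- `n^n = Σ_{(T,v*) ∈ 𝒜*_n} ∏_{v internal} b(v)`, where `b(v) = h_v` if `v` is on
the path from the root to the distinguished vertex and `b(v) = h_v + 1` otherwise,
the sum being over all pointed André trees on `n` vertices. -/
theorem stmt10 (n : ℕ) (hn : 1 ≤ n) :
    n ^ n
      = ∑ x ∈ pointedAndreTrees n, ∏ v ∈ internalsA n x.1,
          (if OnPath n x.1 x.2 v then hookA n x.1 v else hookA n x.1 v + 1) := by
  have hpos : ∀ p ∈ forestsBelow n n, 1 ≤ (rootsBelow n p).card := fun p hp => by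
    obtain ⟨c, hc, -⟩ := exists_root_reaches hp ⟨0, hn⟩ hn
    exact Finset.card_pos.2 ⟨c, hc⟩
  have htotal := unmarkedSum_add_markedSum (n := n) (i := n) 0 rfl
  have hunmarked : unmarkedSum n n (fun r => (n : ℤ) ^ 0 * Nat.descFactorial 0 r) = 0 :=
    Finset.sum_eq_zero fun p hp => by
      simp [Nat.descFactorial_of_lt (hpos p hp)]
  rw [hunmarked, zero_add, markedSum] at htotal
  have hcast : ((n ^ n : ℕ) : ℤ) = (n : ℤ) ^ n := by push_cast; rfl
  apply Nat.cast_injective (R := ℤ)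
  rw [hcast, ← htotal, Nat.cast_sum, pointedAndreTrees, Finset.sum_filter, Finset.sum_product,
    andreTrees, Finset.sum_filter, ← Finset.sum_subset (Finset.subset_univ (forestsBelow n n))]
  · refine Finset.sum_congr rfl fun p hp => ?_
    split_ifs with h
    · rw [Finset.sum_filter]
      refine Finset.sum_congr rfl fun v _ => ?_
      simp only [childCount_eq h, v.2, true_and, ((isAndreTree_iff hn).1 h).2,
        prod_internalsA_eq (le_of_mem_forestsBelow hp)]
      simp
    · refine Finset.sum_eq_zero fun v _ => ?_
      have h1 : (rootsBelow n p).card ≠ 1 := fun h' => h ((isAndreTree_iff hn).2 ⟨hp, h'⟩)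
      have h2 := hpos p hp
      rw [Nat.descFactorial_of_lt (by omega)]
      simp
  · intro p _ hp
    exact if_neg fun h => hp ((isAndreTree_iff hn).1 h).1
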